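/- arXiv:1908.02306 — 3 statements merged into one kernel-verified Lean document; each statement's English description precedes it below -/
import Mathlib

section
/- Let b > 0, σ > 0, η ∈ ℝ, 0 < μ < 1, and let α, β be real with α − μ > −1 and β > −1. Then for every k ∈ ℕ and every x ∈ (0, b), the right Erdélyi–Kober fractional derivative of the Jacobi–Müntz function of the second kind satisfies (_xD^μ_{b,σ,η} ²J_k^{(α,β,σ,η)})(x) = (Γ(k+α+1)/Γ(k+α−μ+1)) · x^{σ(η+μ)} (b^σ − x^σ)^{α−μ} · P_k^{(α−μ,β+μ)}(2(x/b)^σ − 1). -/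
open Real MeasureTheory Finset

noncomputable def jacobiP (n : ℕ) (a c : ℝ) (x : ℝ) : ℝ :=
  ∑ s ∈ Finset.range (n + 1),
    (Real.Gamma (n + a + 1) * Real.Gamma (n + c + 1)) /
      (Real.Gamma (a + s + 1) * Real.Gamma (n + c - s + 1) * s.factorial * (n - s).factorial) *
      ((x - 1) / 2) ^ s * ((x + 1) / 2) ^ (n - s)

/-- Jacobi–Müntz function of the second kind. -/
noncomputable def J2 (b α β σ η : ℝ) (n : ℕ) (x : ℝ) : ℝ :=
  x ^ (σ * η) * (b ^ σ - x ^ σ) ^ α * jacobiP n α β (2 * (x / b) ^ σ - 1)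

/-- Right Erdélyi–Kober fractional integral. -/
noncomputable def EKIright (b σ η μ : ℝ) (f : ℝ → ℝ) (x : ℝ) : ℝ :=
  σ * x ^ (σ * η) / Real.Gamma μ *
    ∫ t in x..b, (t ^ σ - x ^ σ) ^ (μ - 1) * t ^ (-(σ * (η + μ - 1)) - 1) * f t

/-- Right Erdélyi–Kober fractional derivative (0 < μ < 1). -/
noncomputable def EKDright (b σ η μ : ℝ) (f : ℝ → ℝ) (x : ℝ) : ℝ :=
  x ^ (σ * (η + μ)) *
    (-(σ * x ^ (σ - 1))⁻¹ *
      deriv (fun y => y ^ (-(σ * (μ + η - 1))) * EKIright b σ (η + μ - 1) (1 - μ) f y) x)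

theorem gamma_dp (n : ℕ) (x : ℝ) (h : 0 < x - n + 1) :
    Real.Gamma (x + 1) = (descPochhammer ℤ n).smeval x * Real.Gamma (x - n + 1) := by
  induction n with
  | zero => simp
  | succ n ih =>
    push_cast at h ⊢
    rw [ih (by linarith), descPochhammer_succ_right, Polynomial.smeval_mul,
      Polynomial.smeval_sub, Polynomial.smeval_X, Polynomial.smeval_natCast,
      Real.Gamma_add_one (show x - n ≠ 0 by linarith)]
    have : x - (n + 1) + 1 = x - n := by ring
    rw [this]
    simp
    ring

theorem jacobi_expand (k : ℕ) (a c w : ℝ) (ha : -1 < a) (hc : -1 < c) :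
    jacobiP k a c (2 * w - 1) = ∑ m ∈ Finset.range (k + 1),
      Real.Gamma (k + a + 1) / (Real.Gamma (a + m + 1) * (k - m).factorial * m.factorial) *
        (descPochhammer ℤ m).smeval (a + c + k + m) * (w - 1) ^ m := by
  have hw : ∀ n : ℕ, w ^ n = ∑ j ∈ Finset.range (n + 1), (w - 1) ^ j * (n.choose j : ℝ) := by
    intro n
    have := add_pow (w - 1) 1 n
    simpa using this
  have h1 : (2 * w - 1 - 1) / 2 = w - 1 := by ring
  have h2 : (2 * w - 1 + 1) / 2 = w := by ring
  unfold jacobiP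
  rw [h1, h2]
  simp_rw [hw, Finset.mul_sum]
  have hk : ∀ s ∈ Finset.range (k + 1), k - s + 1 = k + 1 - s := by
    intro s hs
    have := Finset.mem_range.1 hs
    omega
  rw [Finset.sum_congr rfl fun s hs => by rw [hk s hs],
    ← Finset.sum_range_diag_flip (k + 1) (fun s j => Real.Gamma (k + a + 1) *
      Real.Gamma (k + c + 1) / (Real.Gamma (a + s + 1) * Real.Gamma (k + c - s + 1) *
      s.factorial * (k - s).factorial) * (w - 1) ^ s * ((w - 1) ^ j * ((k - s).choose j : ℝ)))]
  refine Finset.sum_congr rfl fun m hm => ?_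
  have hmk : m ≤ k := by have := Finset.mem_range.1 hm; omega
  have hmk' : (m : ℝ) ≤ k := by exact_mod_cast hmk
  rw [show a + c + k + m = (k + c) + (a + m) by ring,
    Ring.descPochhammer_smeval_add m (Commute.all _ _), Finset.mul_sum, Finset.sum_mul,
    Finset.Nat.sum_antidiagonal_eq_sum_range_succ_mk]
  refine Finset.sum_congr rfl fun s hs => ?_
  have hsm : s ≤ m := by have := Finset.mem_range.1 hs; omega
  have hsm' : (s : ℝ) ≤ m := by exact_mod_cast hsm
  have hs0 : (0 : ℝ) ≤ s := by positivity
  have g1 := gamma_dp s (k + c) (by linarith)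
  have g2 := gamma_dp (m - s) (a + m) (by rw [Nat.cast_sub hsm]; linarith)
  rw [Nat.cast_sub hsm, show a + m - (m - s) + 1 = a + s + 1 by ring] at g2
  have p1 : Real.Gamma (a + s + 1) ≠ 0 := (Real.Gamma_pos_of_pos (by linarith)).ne'
  have p2 : Real.Gamma (k + c - s + 1) ≠ 0 := (Real.Gamma_pos_of_pos (by linarith)).ne'
  have p3 : (descPochhammer ℤ (m - s)).smeval (a + m) ≠ 0 := by
    intro h
    rw [h, zero_mul] at g2
    exact (Real.Gamma_pos_of_pos (by linarith)).ne' g2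
  have f1 : ((k - s).choose (m - s) : ℝ) = (k - s).factorial /
      ((m - s).factorial * (k - m).factorial) := by
    rw [Nat.cast_choose ℝ (by omega), show k - s - (m - s) = k - m by omega]
  have f2 : (m.choose s : ℝ) = m.factorial / (s.factorial * (m - s).factorial) := by
    rw [Nat.cast_choose ℝ hsm]
  have f3 : (w - 1) ^ m = (w - 1) ^ s * (w - 1) ^ (m - s) := by
    rw [← pow_add]; congr 1; omega
  have q1 : ((k - s).factorial : ℝ) ≠ 0 := by positivity
  have q2 : ((m - s).factorial : ℝ) ≠ 0 := by positivity
  have q3 : ((k - m).factorial : ℝ) ≠ 0 := by positivity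
  have q4 : (s.factorial : ℝ) ≠ 0 := by positivity
  have q5 : (m.factorial : ℝ) ≠ 0 := by positivity
  rw [g1, g2, f1, f2, f3]
  field_simp

theorem real_beta (p q Y B : ℝ) (hp : 0 < p) (hq : 0 < q) (h : Y < B) :
    ∫ u in Y..B, (u - Y) ^ (p - 1) * (B - u) ^ (q - 1) =
      (B - Y) ^ (p + q - 1) * (Real.Gamma p * Real.Gamma q / Real.Gamma (p + q)) := by
  have hpos : 0 < B - Y := by linarith
  have h1 := Complex.betaIntegral_scaled p q hpos
  have h2 := intervalIntegral.integral_comp_sub_right (a := Y) (b := B)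
    (fun u => u ^ (p - 1) * (B - Y - u) ^ (q - 1)) Y
  simp only [sub_self, sub_sub_sub_cancel_right] at h2
  rw [h2]
  have h3 := Complex.betaIntegral_eq_Gamma_mul_div (p : ℂ) q (by simpa) (by simpa)
  rw [h3] at h1
  have h4 : ∫ x in (0 : ℝ)..(B - Y), (x : ℂ) ^ ((p : ℂ) - 1) * (((B - Y : ℝ) : ℂ) - x) ^ ((q : ℂ) - 1)
      = ∫ x in (0 : ℝ)..(B - Y), ((x ^ (p - 1) * (B - Y - x) ^ (q - 1) : ℝ) : ℂ) := by
    refine intervalIntegral.integral_congr fun x hx => ?_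
    rw [Set.uIcc_of_le hpos.le] at hx
    have e1 : 0 ≤ B - Y - x := by linarith [hx.2]
    rw [Complex.ofReal_mul, Complex.ofReal_cpow hx.1, Complex.ofReal_cpow e1]
    push_cast
    rfl
  rw [h4, intervalIntegral.integral_ofReal] at h1
  rw [← Complex.ofReal_add, Complex.Gamma_ofReal, Complex.Gamma_ofReal, Complex.Gamma_ofReal,
    ← Complex.ofReal_one, ← Complex.ofReal_sub, ← Complex.ofReal_cpow hpos.le] at h1
  exact_mod_cast h1

theorem real_beta_integrable (p q Y B : ℝ) (hp : 0 < p) (hq : 0 < q) (h : Y < B) :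
    IntervalIntegrable (fun u => (u - Y) ^ (p - 1) * (B - u) ^ (q - 1)) volume Y B := by
  by_contra hn
  have h1 := real_beta p q Y B hp hq h
  rw [intervalIntegral.integral_undef hn] at h1
  have := Real.Gamma_pos_of_pos hp
  have := Real.Gamma_pos_of_pos hq
  have := Real.Gamma_pos_of_pos (add_pos hp hq)
  have := Real.rpow_pos_of_pos (sub_pos.2 h) (p + q - 1)
  have : 0 < (B - Y) ^ (p + q - 1) * (Real.Gamma p * Real.Gamma q / Real.Gamma (p + q)) := by
    positivity
  linarith

theorem subst_rpow (σ y b : ℝ) (hσ : 0 < σ) (hy : 0 < y) (hyb : y < b) (g : ℝ → ℝ) :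
    ∫ t in y..b, σ * t ^ (σ - 1) * g (t ^ σ) = ∫ u in (y ^ σ)..(b ^ σ), g u := by
  have hlt : y ^ σ < b ^ σ := Real.rpow_lt_rpow hy.le hyb hσ
  rw [intervalIntegral.integral_of_le hyb.le, intervalIntegral.integral_of_le hlt.le]
  have him : (fun t : ℝ => t ^ σ) '' Set.Ioc y b = Set.Ioc (y ^ σ) (b ^ σ) := by
    ext u
    constructor
    · rintro ⟨t, ht, rfl⟩
      have : 0 < t := hy.trans ht.1
      exact ⟨Real.rpow_lt_rpow hy.le ht.1 hσ, Real.rpow_le_rpow this.le ht.2 hσ.le⟩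
    · intro hu
      have hy' := Real.rpow_pos_of_pos hy σ
      have hu0 : 0 < u := hy'.trans hu.1
      refine ⟨u ^ σ⁻¹, ⟨?_, ?_⟩, ?_⟩
      · rw [Real.lt_rpow_inv_iff_of_pos hy.le hu0.le hσ]; exact hu.1
      · rw [Real.rpow_inv_le_iff_of_pos hu0.le (hy.trans hyb).le hσ]; exact hu.2
      · exact Real.rpow_inv_rpow hu0.le hσ.ne'
  rw [← him, integral_image_eq_integral_abs_deriv_smul (f' := fun t => σ * t ^ (σ - 1))
    measurableSet_Ioc]
  · refine setIntegral_congr_fun measurableSet_Ioc fun t ht => ?_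
    have h0 : 0 < t := hy.trans ht.1
    have := Real.rpow_pos_of_pos h0 (σ - 1)
    simp only [smul_eq_mul]
    rw [abs_of_pos (by positivity)]
  · intro t ht
    have h0 : 0 < t := hy.trans ht.1
    exact (Real.hasDerivAt_rpow_const (Or.inl h0.ne')).hasDerivWithinAt
  · intro t ht s hs hts
    have h0 : 0 < t := hy.trans ht.1
    have h1 : 0 < s := hy.trans hs.1
    exact Real.rpow_left_injOn hσ.ne' h0.le h1.le hts

/-- closed form of the inner function -/
theorem inner_closed (b σ η μ α β : ℝ) (hσ : 0 < σ) (hμ0 : 0 < μ) (hμ1 : μ < 1)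
    (hα : α - μ > -1) (hβ : β > -1) (k : ℕ) (y : ℝ) (hy : 0 < y) (hyb : y < b) :
    y ^ (-(σ * (μ + η - 1))) * EKIright b σ (η + μ - 1) (1 - μ) (J2 b α β σ η k) y =
    ∑ m ∈ Finset.range (k + 1),
      Real.Gamma (k + α + 1) / ((k - m).factorial * m.factorial) *
        (descPochhammer ℤ m).smeval (α + β + k + m) * (-(b ^ σ)⁻¹) ^ m /
        Real.Gamma (α - μ + m + 1 + 1) *
        (b ^ σ - y ^ σ) ^ (α - μ + m + 1) := by
  have hb : 0 < b := hy.trans hyb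
  have hB : 0 < b ^ σ := Real.rpow_pos_of_pos hb σ
  have hlt : y ^ σ < b ^ σ := Real.rpow_lt_rpow hy.le hyb hσ
  have hG : 0 < Real.Gamma (1 - μ) := Real.Gamma_pos_of_pos (by linarith)
  unfold EKIright
  set C : ℕ → ℝ := fun m => Real.Gamma (k + α + 1) /
    (Real.Gamma (α + m + 1) * (k - m).factorial * m.factorial) *
        (descPochhammer ℤ m).smeval (α + β + k + m) * (-(b ^ σ)⁻¹) ^ m with hC
  set g : ℝ → ℝ := fun u => ∑ m ∈ Finset.range (k + 1),
    C m * ((u - y ^ σ) ^ (1 - μ - 1) * (b ^ σ - u) ^ (α + m + 1 - 1)) with hg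
  have hint : σ * (∫ t in y..b, (t ^ σ - y ^ σ) ^ (1 - μ - 1) *
      t ^ (-(σ * (η + μ - 1 + (1 - μ) - 1)) - 1) * J2 b α β σ η k t) =
      ∫ u in (y ^ σ)..(b ^ σ), g u := by
    rw [← subst_rpow σ y b hσ hy hyb g, ← intervalIntegral.integral_const_mul,
      intervalIntegral.integral_of_le hyb.le, intervalIntegral.integral_of_le hyb.le,
      integral_Ioc_eq_integral_Ioo, integral_Ioc_eq_integral_Ioo]
    refine setIntegral_congr_fun measurableSet_Ioo fun t ht => ?_
    have h0 : 0 < t := hy.trans ht.1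
    have htb : 0 < b ^ σ - t ^ σ := sub_pos.2 (Real.rpow_lt_rpow h0.le ht.2 hσ)
    have e1 : t ^ (σ - 1) = t ^ (-(σ * (η + μ - 1 + (1 - μ) - 1)) - 1) * t ^ (σ * η) := by
      rw [← Real.rpow_add h0]; congr 1; ring
    simp only [J2, hg]
    rw [jacobi_expand k α β _ (by linarith) (by linarith), e1]
    simp only [Finset.mul_sum]
    refine Finset.sum_congr rfl fun m hm => ?_
    have e2 : (t / b) ^ σ - 1 = (-(b ^ σ)⁻¹) * (b ^ σ - t ^ σ) := by
      rw [Real.div_rpow h0.le hb.le]; field_simp; ring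
    have e3 : (b ^ σ - t ^ σ) ^ (α + m + 1 - 1) = (b ^ σ - t ^ σ) ^ α * (b ^ σ - t ^ σ) ^ m := by
      rw [add_sub_cancel_right, Real.rpow_add htb, Real.rpow_natCast]
    rw [e2, e3, mul_pow]
    simp only [hC]
    ring
  have hcancel : y ^ (-(σ * (μ + η - 1))) * y ^ (σ * (η + μ - 1)) = 1 := by
    rw [← Real.rpow_add hy, show -(σ * (μ + η - 1)) + σ * (η + μ - 1) = 0 by ring, Real.rpow_zero]
  calc _ = (y ^ (-(σ * (μ + η - 1))) * y ^ (σ * (η + μ - 1))) / Real.Gamma (1 - μ) *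
        (σ * (∫ t in y..b, (t ^ σ - y ^ σ) ^ (1 - μ - 1) *
      t ^ (-(σ * (η + μ - 1 + (1 - μ) - 1)) - 1) * J2 b α β σ η k t)) := by ring
    _ = _ := ?_
  have hm0 : ∀ m : ℕ, (0 : ℝ) ≤ m := fun m => Nat.cast_nonneg m
  rw [hcancel, hint, hg, intervalIntegral.integral_finsetSum, Finset.mul_sum]
  · refine Finset.sum_congr rfl fun m hm => ?_
    have := hm0 m
    rw [intervalIntegral.integral_const_mul,
      real_beta (1 - μ) (α + m + 1) _ _ (by linarith) (by linarith) hlt,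
      show 1 - μ + (α + m + 1) - 1 = α - μ + m + 1 by ring,
      show 1 - μ + (α + m + 1) = α - μ + m + 1 + 1 by ring]
    have p1 : Real.Gamma (α + m + 1) ≠ 0 := (Real.Gamma_pos_of_pos (by linarith)).ne'
    simp only [hC]
    field_simp
  · intro m hm
    have := hm0 m
    exact (real_beta_integrable (1 - μ) (α + m + 1) _ _ (by linarith) (by linarith) hlt).const_mul _

theorem right_EK_derivative_of_J2
    (b σ η μ α β : ℝ) (hb : 0 < b) (hσ : 0 < σ) (hμ0 : 0 < μ) (hμ1 : μ < 1)
    (hα : α - μ > -1) (hβ : β > -1) (k : ℕ) (x : ℝ) (hx : x ∈ Set.Ioo 0 b) :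
    EKDright b σ η μ (J2 b α β σ η k) x =
      Real.Gamma (k + α + 1) / Real.Gamma (k + α - μ + 1) *
        (x ^ (σ * (η + μ)) * (b ^ σ - x ^ σ) ^ (α - μ) *
          jacobiP k (α - μ) (β + μ) (2 * (x / b) ^ σ - 1)) := by
  obtain ⟨hx0, hxb⟩ := hx
  have hB : 0 < b ^ σ := Real.rpow_pos_of_pos hb σ
  have hlt : 0 < b ^ σ - x ^ σ := sub_pos.2 (Real.rpow_lt_rpow hx0.le hxb hσ)
  have hm0 : ∀ m : ℕ, (0 : ℝ) ≤ m := fun m => Nat.cast_nonneg m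
  unfold EKDright
  have hev : (fun y => y ^ (-(σ * (μ + η - 1))) *
      EKIright b σ (η + μ - 1) (1 - μ) (J2 b α β σ η k) y) =ᶠ[nhds x] fun y =>
      ∑ m ∈ Finset.range (k + 1),
      Real.Gamma (k + α + 1) / ((k - m).factorial * m.factorial) *
        (descPochhammer ℤ m).smeval (α + β + k + m) * (-(b ^ σ)⁻¹) ^ m /
        Real.Gamma (α - μ + m + 1 + 1) *
        (b ^ σ - y ^ σ) ^ (α - μ + m + 1) := by
    filter_upwards [Ioo_mem_nhds hx0 hxb] with y hy
    exact inner_closed b σ η μ α β hσ hμ0 hμ1 hα hβ k y hy.1 hy.2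
  have hder : ∀ m : ℕ, HasDerivAt (fun y : ℝ => (b ^ σ - y ^ σ) ^ (α - μ + m + 1))
      (-(σ * x ^ (σ - 1)) * (α - μ + m + 1) * (b ^ σ - x ^ σ) ^ (α - μ + m + 1 - 1)) x := by
    intro m
    have h1 : HasDerivAt (fun y : ℝ => b ^ σ - y ^ σ) (-(σ * x ^ (σ - 1))) x :=
      (Real.hasDerivAt_rpow_const (Or.inl hx0.ne')).const_sub _
    exact h1.rpow_const (Or.inl hlt.ne')
  rw [hev.deriv_eq, (HasDerivAt.fun_sum fun m _ => (hder m).const_mul _).deriv,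
    jacobi_expand k (α - μ) (β + μ) _ (by linarith) (by linarith)]
  simp only [Finset.mul_sum]
  refine Finset.sum_congr rfl fun m hm => ?_
  have := hm0 m
  have hk := hm0 k
  have e2 : (x / b) ^ σ - 1 = (-(b ^ σ)⁻¹) * (b ^ σ - x ^ σ) := by
    rw [Real.div_rpow hx0.le hb.le]; field_simp; ring
  have e3 : (b ^ σ - x ^ σ) ^ (α - μ + m + 1 - 1) =
      (b ^ σ - x ^ σ) ^ (α - μ) * (b ^ σ - x ^ σ) ^ m := by
    rw [add_sub_cancel_right, Real.rpow_add hlt, Real.rpow_natCast]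
  have hne : α - μ + m + 1 ≠ 0 := by linarith
  have p1 : Real.Gamma (α - μ + m + 1) ≠ 0 := (Real.Gamma_pos_of_pos (by linarith)).ne'
  have p2 : Real.Gamma (k + (α - μ) + 1) ≠ 0 := (Real.Gamma_pos_of_pos (by linarith)).ne'
  have hxs : x ^ (σ - 1) ≠ 0 := (Real.rpow_pos_of_pos hx0 _).ne'
  rw [e2, e3, mul_pow, Real.Gamma_add_one hne,
    show α - μ + (β + μ) + k + m = α + β + k + m by ring,
    show (k : ℝ) + α - μ + 1 = k + (α - μ) + 1 by ring]
  generalize (descPochhammer ℤ m).smeval (α + β + k + m) = D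
  generalize (-(b ^ σ)⁻¹) ^ m = E
  generalize (b ^ σ - x ^ σ) ^ m = F
  generalize (b ^ σ - x ^ σ) ^ (α - μ) = H
  field_simp
end

section
/- Let b > 0, σ > 0, α, β > −1, and η, μ ∈ ℝ. Then the family {¹J_n^{(α,β,μ,σ,η)} : n ∈ ℕ} is complete in the weighted Hilbert space L²((0,b), ν₁): the closed linear span of the equivalence classes of the functions ¹J_n^{(α,β,μ,σ,η)} in L²((0,b), ν₁) is the whole space, where ν₁ is Lebesgue measure restricted to (0,b) with density x^{σ−1} x^{σ(2(η+μ)−β)} (b^σ − x^σ)^α. -/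
open Real MeasureTheory Finset

/-- Jacobi–Müntz function of the first kind. -/
noncomputable def J1 (b α β μ σ η : ℝ) (n : ℕ) (x : ℝ) : ℝ :=
  x ^ (σ * (β - η - μ)) * jacobiP n α β (2 * (x / b) ^ σ - 1)

/-- The weighted measure ν₁ on (0,b). -/
noncomputable def nu1 (b σ α β η μ : ℝ) : Measure ℝ :=
  (volume.restrict (Set.Ioo 0 b)).withDensity fun x =>
    ENNReal.ofReal (x ^ (σ - 1) * x ^ (σ * (2 * (η + μ) - β)) * (b ^ σ - x ^ σ) ^ α)

/-- The Jacobi polynomial in the variable `t = (x+1)/2`. -/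
noncomputable def jacPoly (a c : ℝ) (n : ℕ) : Polynomial ℝ :=
  ∑ s ∈ Finset.range (n + 1),
    Polynomial.C ((Real.Gamma (n + a + 1) * Real.Gamma (n + c + 1)) /
      (Real.Gamma (a + s + 1) * Real.Gamma (n + c - s + 1) * s.factorial * (n - s).factorial)) *
      ((Polynomial.X - Polynomial.C 1) ^ s * Polynomial.X ^ (n - s))

lemma jacPoly_eval (a c : ℝ) (n : ℕ) (t : ℝ) :
    (jacPoly a c n).eval t = jacobiP n a c (2 * t - 1) := by
  unfold jacPoly jacobiP
  rw [Polynomial.eval_finset_sum]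
  refine Finset.sum_congr rfl fun s _ => ?_
  have h1 : (2 * t - 1 - 1) / 2 = t - 1 := by ring
  have h2 : (2 * t - 1 + 1) / 2 = t := by ring
  rw [h1, h2]
  simp [mul_assoc]

lemma jacMonic (n s : ℕ) :
    ((Polynomial.X - Polynomial.C 1) ^ s * Polynomial.X ^ (n - s) : Polynomial ℝ).Monic :=
  ((Polynomial.monic_X_sub_C 1).pow s).mul (Polynomial.monic_X_pow _)

lemma jacNatDegree (n s : ℕ) (h : s ≤ n) :
    ((Polynomial.X - Polynomial.C 1) ^ s * Polynomial.X ^ (n - s) : Polynomial ℝ).natDegree = n := by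
  rw [Polynomial.Monic.natDegree_mul ((Polynomial.monic_X_sub_C 1).pow s)
    (Polynomial.monic_X_pow _), Polynomial.natDegree_pow, Polynomial.natDegree_X_sub_C,
    Polynomial.natDegree_X_pow]
  omega

lemma jacPoly_degree (a c : ℝ) (ha : -1 < a) (hc : -1 < c) (n : ℕ) :
    (jacPoly a c n).degree = n := by
  apply Polynomial.degree_eq_of_le_of_coeff_ne_zero
  · apply Polynomial.degree_le_of_natDegree_le
    apply Polynomial.natDegree_sum_le_of_forall_le
    intro s hs
    have hs' : s ≤ n := by simpa [Nat.lt_succ_iff] using hs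
    exact (Polynomial.natDegree_C_mul_le _ _).trans (jacNatDegree n s hs').le
  · unfold jacPoly
    rw [Polynomial.finsetSum_coeff]
    apply ne_of_gt
    apply Finset.sum_pos
    · intro s hs
      have hs' : s ≤ n := by simpa [Nat.lt_succ_iff] using hs
      rw [Polynomial.coeff_C_mul]
      have h1 := (jacMonic n s).coeff_natDegree
      rw [jacNatDegree n s hs'] at h1
      rw [h1, mul_one]
      have hsn : (s : ℝ) ≤ n := by exact_mod_cast hs'
      have hs0 : (0 : ℝ) ≤ s := by positivity
      have g1 : 0 < Real.Gamma (n + a + 1) := Real.Gamma_pos_of_pos (by linarith)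
      have g2 : 0 < Real.Gamma (n + c + 1) := Real.Gamma_pos_of_pos (by linarith)
      have g3 : 0 < Real.Gamma (a + s + 1) := Real.Gamma_pos_of_pos (by linarith)
      have g4 : 0 < Real.Gamma (n + c - s + 1) := Real.Gamma_pos_of_pos (by linarith)
      positivity
    · simp

lemma jacPoly_span (a c : ℝ) (ha : -1 < a) (hc : -1 < c) :
    Submodule.span ℝ (Set.range (jacPoly a c)) = ⊤ := by
  let S : Polynomial.Sequence ℝ := ⟨jacPoly a c, jacPoly_degree a c ha hc⟩
  exact S.span fun i => isUnit_iff_ne_zero.mpr (Polynomial.leadingCoeff_ne_zero.mpr (S.ne_zero i))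

lemma beta_int (α β : ℝ) (hα : α > -1) (hβ : β > -1) :
    IntegrableOn (fun u : ℝ => u ^ β * (1 - u) ^ α) (Set.Ioo 0 1) := by
  have h := Complex.betaIntegral_convergent (u := ((β + 1 : ℝ) : ℂ)) (v := ((α + 1 : ℝ) : ℂ))
    (by rw [Complex.ofReal_re]; linarith) (by rw [Complex.ofReal_re]; linarith)
  rw [intervalIntegrable_iff_integrableOn_Ioo_of_le zero_le_one] at h
  refine (Integrable.norm h).congr ?_
  filter_upwards [ae_restrict_mem measurableSet_Ioo] with u hu
  have h1 : (0 : ℝ) < 1 - u := by linarith [hu.2]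
  have h2 : (1 - (u : ℂ)) = ((1 - u : ℝ) : ℂ) := by push_cast; rfl
  rw [norm_mul, h2, Complex.norm_cpow_eq_rpow_re_of_pos hu.1,
    Complex.norm_cpow_eq_rpow_re_of_pos h1]
  simp

lemma weight_int (b σ α β : ℝ) (hb : 0 < b) (hσ : 0 < σ) (hα : α > -1) (hβ : β > -1) :
    IntegrableOn (fun x : ℝ => x ^ (σ - 1) * (x ^ σ) ^ β * (b ^ σ - x ^ σ) ^ α) (Set.Ioo 0 b) := by
  have h := (integrable_indicator_iff measurableSet_Ioo).mpr (beta_int α β hα hβ)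
  have hc : 0 < b ^ σ := Real.rpow_pos_of_pos hb σ
  have h2 := (h.comp_div hc.ne').integrableOn (s := Set.Ioi 0)
  have h3 := ((integrableOn_Ioi_comp_rpow_iff' _ hσ.ne').mpr h2).mono_set
    (show Set.Ioo 0 b ⊆ Set.Ioi 0 from Set.Ioo_subset_Ioi_self)
  refine (Integrable.const_mul h3 ((b ^ σ) ^ β * (b ^ σ) ^ α)).congr ?_
  filter_upwards [ae_restrict_mem measurableSet_Ioo] with x hx
  have hx0 : 0 < x ^ σ := Real.rpow_pos_of_pos hx.1 σ
  have hxb : x ^ σ < b ^ σ := Real.rpow_lt_rpow hx.1.le hx.2 hσ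
  have hm : x ^ σ / b ^ σ ∈ Set.Ioo (0 : ℝ) 1 := ⟨by positivity, (div_lt_one hc).mpr hxb⟩
  rw [Set.indicator_of_mem hm]
  have e1 : (1 - x ^ σ / b ^ σ) = (b ^ σ - x ^ σ) / b ^ σ := by field_simp
  rw [e1, Real.div_rpow hx0.le hc.le, Real.div_rpow (by linarith) hc.le, smul_eq_mul]
  have p1 : 0 < (b ^ σ) ^ β := Real.rpow_pos_of_pos hc _
  have p2 : 0 < (b ^ σ) ^ α := Real.rpow_pos_of_pos hc _
  field_simp

lemma ae_mem (b σ α β η μ : ℝ) : ∀ᵐ x ∂(nu1 b σ α β η μ), x ∈ Set.Ioo 0 b :=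
  (withDensity_absolutelyContinuous _ _).ae_le (ae_restrict_mem measurableSet_Ioo)

lemma memLp_base (b σ α β η μ : ℝ) (hb : 0 < b) (hσ : 0 < σ) (hα : α > -1) (hβ : β > -1) :
    MemLp (fun x : ℝ => x ^ (σ * (β - η - μ))) 2 (nu1 b σ α β η μ) := by
  have hm : Measurable (fun x : ℝ => x ^ (σ * (β - η - μ))) := by fun_prop
  rw [memLp_two_iff_integrable_sq hm.aestronglyMeasurable]
  unfold nu1
  rw [integrable_withDensity_iff (by fun_prop) (by simp)]
  refine Integrable.congr (weight_int b σ α β hb hσ hα hβ) ?_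
  filter_upwards [ae_restrict_mem measurableSet_Ioo] with x hx
  have hx0 : 0 < x := hx.1
  have hxb : x ^ σ < b ^ σ := Real.rpow_lt_rpow hx.1.le hx.2 hσ
  have p : 0 ≤ (b ^ σ - x ^ σ) ^ α := Real.rpow_nonneg (by linarith) _
  rw [ENNReal.toReal_ofReal (by positivity), ← Real.rpow_natCast, ← Real.rpow_mul hx0.le,
    ← Real.rpow_mul hx0.le]
  have : x ^ (σ * β) = x ^ (σ * (β - η - μ) * (2 : ℕ)) * x ^ (σ * (2 * (η + μ) - β)) := by
    rw [← Real.rpow_add hx0]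
    congr 1
    push_cast
    ring
  rw [this]
  ring

lemma t_mem (b σ x : ℝ) (hb : 0 < b) (hσ : 0 < σ) (hx : x ∈ Set.Ioo 0 b) :
    (x / b) ^ σ ∈ Set.Icc (0 : ℝ) 1 :=
  ⟨Real.rpow_nonneg (div_nonneg hx.1.le hb.le) _,
    Real.rpow_le_one (div_nonneg hx.1.le hb.le) ((div_le_one hb).mpr hx.2.le) hσ.le⟩

lemma poly_bdd (b σ α β η μ : ℝ) (hb : 0 < b) (hσ : 0 < σ) (p : Polynomial ℝ) :
    ∃ C, ∀ᵐ x ∂(nu1 b σ α β η μ), ‖p.eval ((x / b) ^ σ)‖ ≤ C := by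
  obtain ⟨C, hC⟩ := isCompact_Icc.exists_bound_of_continuousOn
    (p.continuous.continuousOn (s := Set.Icc (0 : ℝ) 1))
  refine ⟨C, ?_⟩
  filter_upwards [ae_mem b σ α β η μ] with x hx
  exact hC _ (t_mem b σ x hb hσ hx)

lemma poly_meas (b σ : ℝ) (p : Polynomial ℝ) :
    Measurable (fun x : ℝ => p.eval ((x / b) ^ σ)) :=
  p.continuous.measurable.comp (by fun_prop)

lemma memLp_J1 (b σ α β η μ : ℝ) (hb : 0 < b) (hσ : 0 < σ) (hα : α > -1) (hβ : β > -1) (n : ℕ) :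
    MemLp (J1 b α β μ σ η n) 2 (nu1 b σ α β η μ) := by
  have hbase := memLp_base b σ α β η μ hb hσ hα hβ
  obtain ⟨C, hC⟩ := poly_bdd b σ α β η μ hb hσ (jacPoly α β n)
  have hJ : J1 b α β μ σ η n =
      fun x => x ^ (σ * (β - η - μ)) * (jacPoly α β n).eval ((x / b) ^ σ) := by
    funext x
    rw [jacPoly_eval]
    rfl
  rw [hJ]
  refine MemLp.of_le_mul (c := C) hbase
    (hbase.1.mul (poly_meas b σ _).aestronglyMeasurable) ?_
  filter_upwards [hC] with x hx
  rw [norm_mul, mul_comm]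
  gcongr

lemma key (b σ α β η μ : ℝ) (hb : 0 < b) (hσ : 0 < σ) (G : ℝ → ℝ)
    (hG : Integrable G (nu1 b σ α β η μ))
    (h : ∀ p : Polynomial ℝ, ∫ x, p.eval ((x / b) ^ σ) * G x ∂(nu1 b σ α β η μ) = 0) :
    ∀ᵐ x ∂(nu1 b σ α β η μ), G x = 0 := by
  apply ae_eq_zero_of_integral_contDiff_smul_eq_zero hG.locallyIntegrable
  intro φ hφ hφc
  have hcont : Continuous φ := hφ.continuous
  obtain ⟨M, hM⟩ := hφc.exists_bound_of_continuous hcont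
  have hφG : Integrable (fun x => φ x * G x) (nu1 b σ α β η μ) :=
    hG.bdd_mul hcont.aestronglyMeasurable (Filter.Eventually.of_forall hM)
  have hc2 : Continuous (fun t : ℝ => φ (b * t ^ σ⁻¹)) :=
    hcont.comp (continuous_const.mul (Real.continuous_rpow_const (inv_nonneg.mpr hσ.le)))
  have main : ∀ ε > 0, ‖∫ x, φ x • G x ∂(nu1 b σ α β η μ)‖ ≤
      ε * ∫ x, ‖G x‖ ∂(nu1 b σ α β η μ) := by
    intro ε hε
    obtain ⟨p, hp⟩ := exists_polynomial_near_of_continuousOn 0 1 _ hc2.continuousOn ε hε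
    obtain ⟨C, hC⟩ := poly_bdd b σ α β η μ hb hσ p
    have hpG : Integrable (fun x => p.eval ((x / b) ^ σ) * G x) (nu1 b σ α β η μ) :=
      hG.bdd_mul (poly_meas b σ p).aestronglyMeasurable hC
    have e : ∫ x, φ x • G x ∂(nu1 b σ α β η μ) =
        ∫ x, (φ x * G x - p.eval ((x / b) ^ σ) * G x) ∂(nu1 b σ α β η μ) := by
      rw [integral_sub hφG hpG, h p, sub_zero]
      rfl
    rw [e, ← integral_const_mul]
    refine norm_integral_le_of_norm_le (hG.norm.const_mul ε) ?_
    filter_upwards [ae_mem b σ α β η μ] with x hx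
    have hxb : 0 ≤ x / b := div_nonneg hx.1.le hb.le
    have h1 := hp _ (t_mem b σ x hb hσ hx)
    have h2 : b * ((x / b) ^ σ) ^ σ⁻¹ = x := by
      rw [Real.rpow_rpow_inv hxb hσ.ne']
      field_simp
    rw [h2, abs_sub_comm] at h1
    rw [← sub_mul, norm_mul]
    gcongr
    exact h1.le
  set I := ∫ x, ‖G x‖ ∂(nu1 b σ α β η μ)
  have hI : 0 ≤ I := integral_nonneg fun _ => norm_nonneg _
  rw [← norm_le_zero_iff]
  refine le_of_forall_pos_le_add fun δ hδ => ?_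
  have := main (δ / (I + 1)) (by positivity)
  refine this.trans ?_
  rw [zero_add, div_mul_eq_mul_div, div_le_iff₀ (by positivity)]
  nlinarith

theorem completeness_J1
    (b σ α β η μ : ℝ) (hb : 0 < b) (hσ : 0 < σ) (hα : α > -1) (hβ : β > -1) :
    (Submodule.span ℝ
        {g : Lp ℝ 2 (nu1 b σ α β η μ) |
          ∃ n : ℕ, (g : ℝ → ℝ) =ᵐ[nu1 b σ α β η μ] J1 b α β μ σ η n}).topologicalClosure = ⊤ := by
  rw [Submodule.topologicalClosure_eq_top_iff, Submodule.eq_bot_iff]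
  intro f hf
  have hbase := memLp_base b σ α β η μ hb hσ hα hβ
  have hG : Integrable (fun x => x ^ (σ * (β - η - μ)) * f x) (nu1 b σ α β η μ) :=
    hbase.integrable_mul (Lp.memLp f)
  have hint : ∀ p : Polynomial ℝ, Integrable
      (fun x => p.eval ((x / b) ^ σ) * (x ^ (σ * (β - η - μ)) * f x)) (nu1 b σ α β η μ) := by
    intro p
    obtain ⟨C, hC⟩ := poly_bdd b σ α β η μ hb hσ p
    exact hG.bdd_mul (poly_meas b σ p).aestronglyMeasurable hC
  have hJ : ∀ n, ∫ x, (jacPoly α β n).eval ((x / b) ^ σ) * (x ^ (σ * (β - η - μ)) * f x)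
      ∂(nu1 b σ α β η μ) = 0 := by
    intro n
    have hm := memLp_J1 b σ α β η μ hb hσ hα hβ n
    have h0 := (Submodule.mem_orthogonal _ _).mp hf (hm.toLp _)
      (Submodule.subset_span ⟨n, hm.coeFn_toLp⟩)
    rw [L2.inner_def] at h0
    rw [← h0]
    apply integral_congr_ae
    filter_upwards [hm.coeFn_toLp] with x hx
    rw [hx, jacPoly_eval]
    simp only [J1, RCLike.inner_apply, conj_trivial]
    ring
  have hall : ∀ p : Polynomial ℝ,
      ∫ x, p.eval ((x / b) ^ σ) * (x ^ (σ * (β - η - μ)) * f x) ∂(nu1 b σ α β η μ) = 0 := by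
    intro p
    have hp : p ∈ Submodule.span ℝ (Set.range (jacPoly α β)) := by
      rw [jacPoly_span α β hα hβ]
      trivial
    induction hp using Submodule.span_induction with
    | mem q hq =>
      obtain ⟨n, rfl⟩ := hq
      exact hJ n
    | zero => simp
    | add q r _ _ hq hr =>
      simp only [Polynomial.eval_add, add_mul]
      rw [integral_add (hint q) (hint r), hq, hr, add_zero]
    | smul a q _ hq =>
      simp only [Polynomial.eval_smul, smul_eq_mul, mul_assoc]
      rw [integral_const_mul, hq, mul_zero]
  have hz := key b σ α β η μ hb hσ _ hG hall
  apply (Lp.eq_zero_iff_ae_eq_zero).mpr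
  filter_upwards [hz, ae_mem b σ α β η μ] with x hx hxm
  have : 0 < x ^ (σ * (β - η - μ)) := Real.rpow_pos_of_pos hxm.1 _
  simpa [this.ne'] using hx
end

section
/- Let b > 0, σ > 0, α, β > −1, and η ∈ ℝ. Then the family {²J_n^{(α,β,σ,η)} : n ∈ ℕ} is complete in the weighted Hilbert space L²((0,b), ν₂): the closed linear span of the equivalence classes of the functions ²J_n^{(α,β,σ,η)} in L²((0,b), ν₂) is the whole space, where ν₂ is Lebesgue measure restricted to (0,b) with density x^{σ−1} x^{σ(β−2η)} (b^σ − x^σ)^{−α}. -/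
open Real MeasureTheory Finset

/-- The weighted measure ν₂ on (0,b). -/
noncomputable def nu2 (b σ α β η : ℝ) : Measure ℝ :=
  (volume.restrict (Set.Ioo 0 b)).withDensity fun x =>
    ENNReal.ofReal (x ^ (σ - 1) * x ^ (σ * (β - 2 * η)) * (b ^ σ - x ^ σ) ^ (-α))

lemma aux_beta_integrable (B α β : ℝ) (hB : 0 < B) (hα : α > -1) (hβ : β > -1) :
    IntegrableOn (fun u : ℝ => u ^ β * (B - u) ^ α) (Set.Ioo 0 B) := by
  have h1 : IntervalIntegrable (fun u : ℝ => u ^ β * (B - u) ^ α) volume 0 (B / 2) := by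
    apply IntervalIntegrable.mul_continuousOn (intervalIntegral.intervalIntegrable_rpow' hβ)
    rw [Set.uIcc_of_le (by linarith)]
    apply ContinuousOn.rpow_const (by fun_prop)
    intro x hx
    left
    have := hx.2
    linarith
  have h2 : IntervalIntegrable (fun u : ℝ => u ^ β * (B - u) ^ α) volume (B / 2) B := by
    have h3 : IntervalIntegrable (fun u : ℝ => (B - u) ^ α) volume (B / 2) B := by
      have := (intervalIntegral.intervalIntegrable_rpow' (a := B / 2) (b := 0) hα).comp_sub_left B
      convert this using 1 <;> ring
    apply IntervalIntegrable.continuousOn_mul h3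
    rw [Set.uIcc_of_le (by linarith)]
    apply ContinuousOn.rpow_const (by fun_prop)
    intro x hx
    left
    have := hx.1
    linarith
  have := h1.trans h2
  rw [intervalIntegrable_iff_integrableOn_Ioo_of_le hB.le] at this
  exact this

lemma aux_weight_integrable (b σ α β : ℝ) (hb : 0 < b) (hσ : 0 < σ) (hα : α > -1) (hβ : β > -1) :
    IntegrableOn (fun x : ℝ => x ^ (σ - 1) * ((x ^ σ) ^ β * (b ^ σ - x ^ σ) ^ α))
      (Set.Ioo 0 b) := by
  have hB : 0 < b ^ σ := Real.rpow_pos_of_pos hb σ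
  have h := aux_beta_integrable (b ^ σ) α β hB hα hβ
  rw [← integrable_indicator_iff measurableSet_Ioo] at h
  have h2 := (integrableOn_Ioi_comp_rpow_iff' _ hσ.ne').mpr h.integrableOn
  refine (h2.mono_set Set.Ioo_subset_Ioi_self).congr_fun ?_ measurableSet_Ioo
  intro x hx
  have hx' : x ^ σ ∈ Set.Ioo 0 (b ^ σ) :=
    ⟨Real.rpow_pos_of_pos hx.1 σ, Real.rpow_lt_rpow hx.1.le hx.2 hσ⟩
  simp only [smul_eq_mul]
  rw [Set.indicator_of_mem hx']

lemma aux_ae_mem (b σ α β η : ℝ) : ∀ᵐ x ∂(nu2 b σ α β η), x ∈ Set.Ioo 0 b := by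
  unfold nu2
  exact (withDensity_absolutelyContinuous _ _).ae_le (ae_restrict_mem measurableSet_Ioo)

lemma aux_memLp_w (b σ α β η : ℝ) (hb : 0 < b) (hσ : 0 < σ) (hα : α > -1) (hβ : β > -1) :
    MemLp (fun x : ℝ => x ^ (σ * η) * (b ^ σ - x ^ σ) ^ α) 2 (nu2 b σ α β η) := by
  have hm : Measurable (fun x : ℝ => x ^ (σ * η) * (b ^ σ - x ^ σ) ^ α) := by fun_prop
  rw [memLp_two_iff_integrable_sq hm.aestronglyMeasurable]
  unfold nu2
  rw [integrable_withDensity_iff (by fun_prop) (by simp)]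
  refine (aux_weight_integrable b σ α β hb hσ hα hβ).congr_fun ?_ measurableSet_Ioo
  intro x hx
  have h0 := hx.1
  have h1 : 0 < b ^ σ - x ^ σ := sub_pos.2 (Real.rpow_lt_rpow hx.1.le hx.2 hσ)
  have h2 : 0 ≤ x ^ (σ - 1) * x ^ (σ * (β - 2 * η)) * (b ^ σ - x ^ σ) ^ (-α) := by positivity
  simp only
  rw [ENNReal.toReal_ofReal h2, ← Real.rpow_mul h0.le]
  have e1 : x ^ (σ * β) = x ^ (σ * η) * x ^ (σ * η) * x ^ (σ * (β - 2 * η)) := by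
    rw [← Real.rpow_add h0, ← Real.rpow_add h0]; ring_nf
  have e2 : (b ^ σ - x ^ σ) ^ α
      = (b ^ σ - x ^ σ) ^ α * (b ^ σ - x ^ σ) ^ α * (b ^ σ - x ^ σ) ^ (-α) := by
    rw [← Real.rpow_add h1, ← Real.rpow_add h1]; ring_nf
  rw [e1]
  conv_lhs => rw [e2]
  ring

noncomputable def auxC (n : ℕ) (a c : ℝ) (s : ℕ) : ℝ :=
  (Real.Gamma (n + a + 1) * Real.Gamma (n + c + 1)) /
      (Real.Gamma (a + s + 1) * Real.Gamma (n + c - s + 1) * s.factorial * (n - s).factorial)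

noncomputable def auxPoly (a c : ℝ) (n : ℕ) : Polynomial ℝ :=
  ∑ s ∈ Finset.range (n + 1),
    Polynomial.C (auxC n a c s) *
      ((Polynomial.X - Polynomial.C 1) ^ s * Polynomial.X ^ (n - s))

lemma auxC_pos (n : ℕ) (a c : ℝ) (ha : a > -1) (hc : c > -1) (s : ℕ) (hs : s ≤ n) :
    0 < auxC n a c s := by
  unfold auxC
  have hn : (0 : ℝ) ≤ n := n.cast_nonneg
  have hs0 : (0 : ℝ) ≤ s := s.cast_nonneg
  have hs1 : (s : ℝ) ≤ n := by exact_mod_cast hs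
  have g1 := Real.Gamma_pos_of_pos (s := n + a + 1) (by linarith)
  have g2 := Real.Gamma_pos_of_pos (s := n + c + 1) (by linarith)
  have g3 := Real.Gamma_pos_of_pos (s := a + s + 1) (by linarith)
  have g4 := Real.Gamma_pos_of_pos (s := n + c - s + 1) (by linarith)
  positivity

lemma auxPoly_eval (a c : ℝ) (n : ℕ) (t : ℝ) :
    (auxPoly a c n).eval t = jacobiP n a c (2 * t - 1) := by
  unfold auxPoly jacobiP
  rw [Polynomial.eval_finsetSum]
  refine Finset.sum_congr rfl fun s _ => ?_
  simp only [Polynomial.eval_mul, Polynomial.eval_C, Polynomial.eval_pow, Polynomial.eval_sub,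
    Polynomial.eval_X, auxC]
  rw [show (2 * t - 1 - 1) / 2 = t - 1 by ring, show (2 * t - 1 + 1) / 2 = t by ring]
  ring

lemma aux_monic (n s : ℕ) (hs : s ≤ n) :
    ((Polynomial.X - Polynomial.C (1 : ℝ)) ^ s * Polynomial.X ^ (n - s)).Monic ∧
    ((Polynomial.X - Polynomial.C (1 : ℝ)) ^ s * Polynomial.X ^ (n - s)).natDegree = n := by
  have m1 := (Polynomial.monic_X_sub_C (1 : ℝ)).pow s
  have m2 := (Polynomial.monic_X (R := ℝ)).pow (n - s)
  refine ⟨m1.mul m2, ?_⟩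
  rw [m1.natDegree_mul m2, Polynomial.natDegree_pow, Polynomial.natDegree_X_sub_C,
    Polynomial.natDegree_X_pow]
  omega

lemma auxPoly_degree (a c : ℝ) (ha : a > -1) (hc : c > -1) (n : ℕ) :
    (auxPoly a c n).degree = n := by
  apply Polynomial.degree_eq_of_le_of_coeff_ne_zero
  · unfold auxPoly
    apply (Polynomial.degree_sum_le _ _).trans
    apply Finset.sup_le
    intro s hs
    have h := aux_monic n s (by simpa [Nat.lt_succ_iff] using hs)
    apply Polynomial.degree_le_of_natDegree_le
    exact (Polynomial.natDegree_C_mul_le _ _).trans h.2.le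
  · unfold auxPoly
    rw [Polynomial.finsetSum_coeff]
    apply ne_of_gt
    apply Finset.sum_pos
    · intro s hs
      have hs' : s ≤ n := by simpa [Nat.lt_succ_iff] using hs
      have h := aux_monic n s hs'
      have h3 := h.1.coeff_natDegree
      rw [h.2] at h3
      rw [Polynomial.coeff_C_mul, h3, mul_one]
      exact auxC_pos n a c ha hc s hs'
    · simp

noncomputable def auxSeq (a c : ℝ) (ha : a > -1) (hc : c > -1) : Polynomial.Sequence ℝ :=
  ⟨auxPoly a c, auxPoly_degree a c ha hc⟩

theorem completeness_J2
    (b σ α β η : ℝ) (hb : 0 < b) (hσ : 0 < σ) (hα : α > -1) (hβ : β > -1) :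
    (Submodule.span ℝ
        {g : Lp ℝ 2 (nu2 b σ α β η) |
          ∃ n : ℕ, (g : ℝ → ℝ) =ᵐ[nu2 b σ α β η] J2 b α β σ η n}).topologicalClosure = ⊤ := by
  set ν := nu2 b σ α β η with hν
  rw [Submodule.topologicalClosure_eq_top_iff, Submodule.eq_bot_iff]
  intro f hf
  have hmem : ∀ᵐ x ∂ν, x ∈ Set.Ioo 0 b := aux_ae_mem b σ α β η
  set w : ℝ → ℝ := fun x => x ^ (σ * η) * (b ^ σ - x ^ σ) ^ α with hw
  have hwL : MemLp w 2 ν := aux_memLp_w b σ α β η hb hσ hα hβ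
  have hfL : MemLp f 2 ν := Lp.memLp f
  set T : ℝ → ℝ := fun x => (x / b) ^ σ with hT
  have hTm : Measurable T := by fun_prop
  have hTmem : ∀ x ∈ Set.Ioo 0 b, T x ∈ Set.Icc (0 : ℝ) 1 := by
    intro x hx
    have h0 : 0 ≤ x / b := div_nonneg hx.1.le hb.le
    exact ⟨Real.rpow_nonneg h0 _, Real.rpow_le_one h0 ((div_le_one hb).2 hx.2.le) hσ.le⟩
  -- the integrable function
  set F : ℝ → ℝ := fun x => f x * w x with hF
  have hFi : Integrable F ν := hfL.integrable_mul hwL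
  -- bounded polynomials
  have hbound : ∀ p : Polynomial ℝ, ∃ C, ∀ᵐ x ∂ν, ‖p.eval (T x)‖ ≤ C := by
    intro p
    obtain ⟨C, hC⟩ := isCompact_Icc.exists_bound_of_continuousOn (s := Set.Icc (0 : ℝ) 1)
      (f := fun t => p.eval t) p.continuous.continuousOn
    exact ⟨C, hmem.mono fun x hx => hC _ (hTmem x hx)⟩
  have hpm : ∀ p : Polynomial ℝ, Measurable fun x => p.eval (T x) := fun p =>
    p.continuous.measurable.comp hTm
  have hFp : ∀ p : Polynomial ℝ, Integrable (fun x => p.eval (T x) * F x) ν := by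
    intro p
    obtain ⟨C, hC⟩ := hbound p
    exact hFi.bdd_mul (hpm p).aestronglyMeasurable hC
  have hpoly : ∀ p : Polynomial ℝ, ∫ x, p.eval (T x) * F x ∂ν = 0 := by
    intro p
    have hp : p ∈ Submodule.span ℝ (Set.range (auxSeq α β hα hβ)) := by
      rw [Polynomial.Sequence.span]
      · trivial
      · intro i
        rw [isUnit_iff_ne_zero, Polynomial.leadingCoeff_ne_zero]
        exact Polynomial.Sequence.ne_zero _ i
    induction hp using Submodule.span_induction with
    | mem p hp =>
      obtain ⟨n, rfl⟩ := hp
      change ∫ x, (auxPoly α β n).eval (T x) * F x ∂ν = 0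
      have hJ : J2 b α β σ η n = fun x => (auxPoly α β n).eval (T x) * w x := by
        funext x
        rw [auxPoly_eval]
        simp only [J2, hw, hT]
        ring
      have hJL : MemLp (J2 b α β σ η n) 2 ν := by
        rw [hJ]
        obtain ⟨C, hC⟩ := hbound (auxPoly α β n)
        refine hwL.of_le_mul (c := C)
          ((hpm _).aestronglyMeasurable.mul hwL.aestronglyMeasurable) ?_
        filter_upwards [hC] with x hx
        rw [norm_mul]
        exact mul_le_mul_of_nonneg_right hx (norm_nonneg _)
      have h := (Submodule.mem_orthogonal _ f).1 hf (hJL.toLp _)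
        (Submodule.subset_span ⟨n, hJL.coeFn_toLp⟩)
      rw [L2.inner_def] at h
      rw [← h]
      apply integral_congr_ae
      filter_upwards [hJL.coeFn_toLp] with x hx
      rw [hx, hJ]
      simp [hF]
      ring
    | zero => simp
    | add p q _ _ hp hq =>
      simp only [Polynomial.eval_add, add_mul]
      rw [integral_add (hFp p) (hFp q), hp, hq, add_zero]
    | smul c p _ hp =>
      simp only [Polynomial.eval_smul, smul_eq_mul, mul_assoc]
      rw [integral_const_mul, hp, mul_zero]
  have hcont : ∀ g : ℝ → ℝ, Continuous g → ∫ x, g x * F x ∂ν = 0 := by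
    intro g hg
    set G : ℝ → ℝ := fun t => g (b * t ^ (1 / σ)) with hG
    have hGc : ContinuousOn G (Set.Icc 0 1) := by
      apply Continuous.continuousOn
      exact hg.comp (continuous_const.mul (Real.continuous_rpow_const (by positivity)))
    have hGT : ∀ x ∈ Set.Ioo 0 b, G (T x) = g x := by
      intro x hx
      simp only [hG, hT]
      rw [← Real.rpow_mul (div_nonneg hx.1.le hb.le), mul_one_div_cancel hσ.ne', Real.rpow_one,
        mul_div_cancel₀ _ hb.ne']
    have hgF : Integrable (fun x => g x * F x) ν := by
      obtain ⟨C, hC⟩ := isCompact_Icc.exists_bound_of_continuousOn (s := Set.Icc (0 : ℝ) b)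
        hg.continuousOn
      exact hFi.bdd_mul hg.measurable.aestronglyMeasurable
        (hmem.mono fun x hx => hC x ⟨hx.1.le, hx.2.le⟩)
    have hle : ∀ ε > 0, ‖∫ x, g x * F x ∂ν‖ ≤ ε * ∫ x, ‖F x‖ ∂ν := by
      intro ε hε
      obtain ⟨p, hp⟩ := exists_polynomial_near_of_continuousOn 0 1 G hGc ε hε
      have e : ∫ x, g x * F x ∂ν = ∫ x, (g x * F x - p.eval (T x) * F x) ∂ν := by
        rw [integral_sub hgF (hFp p), hpoly p, sub_zero]
      rw [e, ← integral_const_mul]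
      apply norm_integral_le_of_norm_le (hFi.norm.const_mul ε)
      filter_upwards [hmem] with x hx
      rw [← sub_mul, norm_mul]
      apply mul_le_mul_of_nonneg_right _ (norm_nonneg _)
      have := hp (T x) (hTmem x hx)
      rw [hGT x hx, abs_sub_comm] at this
      exact this.le
    by_contra hne
    have hpos : 0 < ‖∫ x, g x * F x ∂ν‖ := norm_pos_iff.2 hne
    have hI : 0 ≤ ∫ x, ‖F x‖ ∂ν := integral_nonneg fun x => norm_nonneg _
    set A := ‖∫ x, g x * F x ∂ν‖
    set I := ∫ x, ‖F x‖ ∂ν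
    have h := hle (A / (2 * (I + 1))) (by positivity)
    rw [div_mul_eq_mul_div, le_div_iff₀ (by positivity)] at h
    nlinarith
  have hF0 : ∀ᵐ x ∂ν, F x = 0 := by
    apply ae_eq_zero_of_integral_contDiff_smul_eq_zero hFi.locallyIntegrable
    intro g hg _
    simpa only [smul_eq_mul] using hcont g hg.continuous
  rw [Lp.eq_zero_iff_ae_eq_zero]
  filter_upwards [hF0, hmem] with x hx hxm
  have h1 : 0 < b ^ σ - x ^ σ := sub_pos.2 (Real.rpow_lt_rpow hxm.1.le hxm.2 hσ)
  have h2 : 0 < w x := mul_pos (Real.rpow_pos_of_pos hxm.1 _) (Real.rpow_pos_of_pos h1 _)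
  exact (mul_eq_zero.1 hx).resolve_right h2.ne'
end
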